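/- The eigenvalues x_1, …, x_{n+1} are pairwise distinct: if i ≠ j then x_i ≠ x_j. -/

import Mathlib

open Polynomial MeasureTheory

/-- Integration of polynomials over `[a, b]` against a weight continuous on `[a, b]`,
as a linear functional. -/
noncomputable def weightedIntegral (a b : ℝ) (w : ℝ → ℝ) (hw : ContinuousOn w (Set.uIcc a b)) :
    ℝ[X] →ₗ[ℝ] ℝ where
  toFun p := ∫ t in a..b, w t * p.eval t
  map_add' p q := by
    simp only [eval_add, mul_add]
    exact intervalIntegral.integral_add
      (hw.mul p.continuous.continuousOn).intervalIntegrable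
      (hw.mul q.continuous.continuousOn).intervalIntegrable
  map_smul' c p := by
    simp only [eval_smul, smul_eq_mul, RingHom.id_apply, mul_left_comm _ c]
    exact intervalIntegral.integral_const_mul _ _

theorem weightedIntegral_apply (a b : ℝ) (w : ℝ → ℝ) (hw : ContinuousOn w (Set.uIcc a b))
    (p : ℝ[X]) : weightedIntegral a b w hw p = ∫ t in a..b, w t * p.eval t :=
  rfl

theorem eq_zero_of_weightedIntegral_mul_self_eq_zero {a b : ℝ} (hab : a < b) {w : ℝ → ℝ}
    (hw : ContinuousOn w (Set.uIcc a b)) (hpos : ∀ t ∈ Set.Ioo a b, 0 < w t) {p : ℝ[X]}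
    (hp : weightedIntegral a b w hw (p * p) = 0) : p = 0 := by
  by_contra hne
  have hw' : ContinuousOn w (Set.Icc a b) := by rwa [Set.uIcc_of_le hab.le] at hw
  have hnonneg : ∀ t ∈ Set.Icc a b, 0 ≤ w t := by
    intro t ht
    rw [← closure_Ioo hab.ne] at ht hw'
    exact le_on_closure (fun s hs => (hpos s hs).le) continuousOn_const hw' ht
  obtain ⟨c, hc, hpc⟩ : ∃ c ∈ Set.Ioo a b, p.eval c ≠ 0 := by
    by_contra! h
    exact hne (p.eq_zero_of_infinite_isRoot ((Set.Ioo_infinite hab).mono h))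
  refine (intervalIntegral.integral_pos hab (hw'.mul (p * p).continuous.continuousOn)
    (fun t ht => ?_) ⟨c, Set.Ioo_subset_Icc_self hc, ?_⟩).ne' hp
  · rw [Pi.mul_apply, eval_mul]
    exact mul_nonneg (hnonneg t (Set.Ioc_subset_Icc_self ht)) (mul_self_nonneg _)
  · rw [Pi.mul_apply, eval_mul]
    exact mul_pos (hpos c hc) (mul_self_pos.2 hpc)

/-- A family of `n + 1` polynomials of degree at most `n` that is orthonormal for a symmetric
form `(p, q) ↦ L (p * q)` spans all polynomials of degree at most `n`. -/
theorem degreeLT_le_span_of_orthonormal {n : ℕ} (L : ℝ[X] →ₗ[ℝ] ℝ) (u : Fin (n + 1) → ℝ[X])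
    (hdeg : ∀ i, (u i).natDegree ≤ n)
    (horth : ∀ i j, L (u i * u j) = if i = j then 1 else 0) :
    degreeLT ℝ (n + 1) ≤ Submodule.span ℝ (Set.range u) := by
  have hli : LinearIndependent ℝ u := by
    rw [Fintype.linearIndependent_iff]
    intro c hc k
    have h := congrArg (fun p => L (p * u k)) hc
    simpa [Finset.sum_mul, horth] using h
  have hle : Submodule.span ℝ (Set.range u) ≤ degreeLT ℝ (n + 1) := by
    rw [Submodule.span_le]
    rintro _ ⟨i, rfl⟩
    exact mem_degreeLT.2 ((natDegree_le_iff_degree_le.1 (hdeg i)).trans_lt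
      (by exact_mod_cast n.lt_succ_self))
  have : Module.Finite ℝ (degreeLT ℝ (n + 1)) :=
    Module.Finite.equiv (degreeLTEquiv ℝ (n + 1)).symm
  refine (Submodule.eq_of_le_of_finrank_eq hle ?_).ge
  rw [finrank_span_eq_card hli, (degreeLTEquiv ℝ (n + 1)).finrank_eq]
  simp

/-- The eigenvalues `x_1, …, x_{n+1}` are pairwise distinct. -/
theorem nodes_distinct
(n : ℕ) (a b : ℝ) (hab : a < b)
    (w : ℝ → ℝ) (hw_cont : ContinuousOn w (Set.Icc a b))
    (hw_pos : ∀ t ∈ Set.Ioo a b, 0 < w t)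
    (u : Fin (n + 1) → Polynomial ℝ) (hu_deg : ∀ i, (u i).natDegree ≤ n)
    (x : Fin (n + 1) → ℝ)
    (horth : ∀ i j, (∫ t in a..b, w t * (u i).eval t * (u j).eval t)
      = if i = j then 1 else 0)
    (heig : ∀ i j, (∫ t in a..b, w t * t * (u i).eval t * (u j).eval t)
      = if i = j then x i else 0)
    (i j : Fin (n + 1)) (hij : i ≠ j) :
    x i ≠ x j := by
  intro hx
  have hw : ContinuousOn w (Set.uIcc a b) := by rwa [Set.uIcc_of_le hab.le]
  set L := weightedIntegral a b w hw with hL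
  have hLorth : ∀ k l, L (u k * u l) = if k = l then 1 else 0 := by
    intro k l
    simp only [hL, weightedIntegral_apply, eval_mul, ← mul_assoc, horth]
  have hLeig : ∀ k l, L (X * (u k * u l)) = if k = l then x k else 0 := by
    intro k l
    simp only [hL, weightedIntegral_apply, eval_mul, eval_X, ← mul_assoc, heig]
  obtain ⟨α, β, hαβ, hlead⟩ : ∃ α β : ℝ, ¬(α = 0 ∧ β = 0) ∧
      α * (u i).coeff n + β * (u j).coeff n = 0 := by
    by_cases h : (u i).coeff n = 0
    · exact ⟨1, 0, by simp, by simp [h]⟩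
    · exact ⟨(u j).coeff n, -(u i).coeff n, by simp [h], by ring⟩
  set f := α • u i + β • u j with hf
  have hf_ne : f ≠ 0 := by
    intro h0
    have hi : L (f * u i) = α := by simp [hf, add_mul, hLorth, hij.symm]
    have hj : L (f * u j) = β := by simp [hf, add_mul, hLorth, hij]
    rw [h0, zero_mul, map_zero] at hi hj
    exact hαβ ⟨hi.symm, hj.symm⟩
  have hf_deg : f.degree < n := by
    rw [degree_lt_iff_coeff_zero]
    intro m hm
    rcases hm.eq_or_lt with rfl | hm
    · simpa [hf] using hlead
    · simp [hf, coeff_eq_zero_of_natDegree_lt ((hu_deg _).trans_lt hm)]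
  have hfu : ∀ k, L ((X - C (x i)) * f * u k) = 0 := by
    intro k
    have h : ∀ l, x l = x i → L ((X - C (x i)) * (u l * u k)) = 0 := by
      intro l hl
      rw [sub_mul, map_sub, ← smul_eq_C_mul, map_smul, hLeig, hLorth, hl]
      split_ifs <;> simp
    have hsplit : (X - C (x i)) * f * u k =
        α • ((X - C (x i)) * (u i * u k)) + β • ((X - C (x i)) * (u j * u k)) := by
      simp only [hf, smul_eq_C_mul]
      ring
    rw [hsplit, map_add, map_smul, map_smul, h i rfl, h j hx.symm]
    simp
  have hspan : Submodule.span ℝ (Set.range u) ≤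
      LinearMap.ker (L ∘ₗ LinearMap.mulLeft ℝ ((X - C (x i)) * f)) := by
    rw [Submodule.span_le]
    rintro _ ⟨k, rfl⟩
    exact hfu k
  have hmem : (X - C (x i)) * f ∈ degreeLT ℝ (n + 1) := by
    rw [mem_degreeLT, degree_mul, degree_X_sub_C, degree_eq_natDegree hf_ne]
    rw [degree_eq_natDegree hf_ne] at hf_deg
    norm_cast at hf_deg ⊢
    lia
  have hzero := eq_zero_of_weightedIntegral_mul_self_eq_zero hab hw hw_pos
    (hspan (degreeLT_le_span_of_orthonormal L u hu_deg hLorth hmem))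
  exact mul_ne_zero (X_sub_C_ne_zero _) hf_ne hzero
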